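/- Let k ≥ 3 be an integer and let φ be a C^{k+1} function on (-1,1). Assume there exists x₀ ∈ (-1,1) such that φ'(x₀) = φ''(x₀) = … = φ^{(k−1)}(x₀) = 0 and φ^{(k)}(x₀) ≠ 0. Then there is a constant c > 0 depending on φ (but not on N) such that for every positive integer N there exists a sequence of complex numbers (a_n)_{n=-N}^{N}, not all zero, satisfying for every real p ≥ 2: ‖∑_{n=-N}^{N} a_n e(n x − n² φ(x))‖_{L^p(-1,1)} ≥ c N^{(2k−1)/(6(k−1)) − (k+1)/(3p(k−1))} (∑_{n=-N}^{N} |a_n|²)^{1/2}. -/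

import Mathlib

open MeasureTheory

/-- `e z = e^{2πiz}`. -/
noncomputable def e (t : ℝ) : ℂ := Complex.exp (2 * Real.pi * Complex.I * t)

open Filter Topology

/-- If all derivatives of `f` of order `< j` vanish at `x₀`, then `f` is close to the leading
monomial of its Taylor polynomial near `x₀`. -/
lemma eventually_abs_sub_leading_term_le {f : ℝ → ℝ} {s : Set ℝ} {x₀ : ℝ} {j : ℕ}
    (hso : IsOpen s) (hsc : Convex ℝ s) (hx₀ : x₀ ∈ s) (hf : ContDiffOn ℝ j f s)
    (hvanish : ∀ i < j, iteratedDerivWithin i f s x₀ = 0) {η : ℝ} (hη : 0 < η) :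
    ∀ᶠ x in 𝓝 x₀,
      |f x - iteratedDerivWithin j f s x₀ / j.factorial * (x - x₀) ^ j| ≤ η * |x - x₀| ^ j := by
  have h := (taylor_isLittleO hsc hx₀ hf).bound hη
  rw [hso.nhdsWithin_eq hx₀] at h
  filter_upwards [h] with x hx
  rw [taylor_within_apply, Finset.sum_range_succ, Finset.sum_eq_zero, zero_add] at hx
  · simp only [Real.norm_eq_abs, abs_pow, smul_eq_mul] at hx
    convert hx using 3
    ring
  · intro i hi
    rw [hvanish i (Finset.mem_range.1 hi), smul_zero]

/-- Two-sided power bounds for the first derivative and an upper bound for the second derivative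
of a function to the right of a degenerate critical point of order `m + 3`. -/
lemma exists_deriv_bounds_of_degenerate {φ : ℝ → ℝ} {s : Set ℝ} {x₀ : ℝ} {m : ℕ}
    (hso : IsOpen s) (hsc : Convex ℝ s) (hx₀ : x₀ ∈ s) (hφ : ContDiffOn ℝ (m + 3 : ℕ) φ s)
    (hvanish : ∀ i, 1 ≤ i → i < m + 3 → iteratedDerivWithin i φ s x₀ = 0)
    (hnonzero : iteratedDerivWithin (m + 3) φ s x₀ ≠ 0) :
    ∃ (φ' φ'' : ℝ → ℝ) (r b B : ℝ), 0 < r ∧ 0 < b ∧ 0 < B ∧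
      ∀ x, x₀ < x → x ≤ x₀ + r → x ∈ s ∧ HasDerivAt φ (φ' x) x ∧ HasDerivAt φ' (φ'' x) x ∧
        b * (x - x₀) ^ (m + 2) ≤ |φ' x| ∧ |φ' x| ≤ B * (x - x₀) ^ (m + 2) ∧
        |φ'' x| ≤ B * (x - x₀) ^ (m + 1) := by
  have hu := hso.uniqueDiffOn (𝕜 := ℝ)
  set φ' := derivWithin φ s with hφ'
  set φ'' := derivWithin φ' s with hφ''
  have hc1 : ContDiffOn ℝ (m + 2 : ℕ) φ' s := hφ.derivWithin hu (by norm_cast)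
  have hc2 : ContDiffOn ℝ (m + 1 : ℕ) φ'' s := hc1.derivWithin hu (by norm_cast)
  have hd {f : ℝ → ℝ} {n : ℕ} (hn : n ≠ 0) (hf : ContDiffOn ℝ n f s) {x : ℝ} (hx : x ∈ s) :
      HasDerivAt f (derivWithin f s x) x :=
    (((hf.differentiableOn (by exact_mod_cast hn)) x hx).hasDerivWithinAt).hasDerivAt
      (hso.mem_nhds hx)
  set A := iteratedDerivWithin (m + 3) φ s x₀ with hA
  have hA1 : iteratedDerivWithin (m + 2) φ' s x₀ = A := by
    rw [hA, hφ', ← iteratedDerivWithin_succ']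
  have hA2 : iteratedDerivWithin (m + 1) φ'' s x₀ = A := by
    rw [← hA1, hφ'', ← iteratedDerivWithin_succ']
  have hA0 : 0 < |A| := abs_pos.2 hnonzero
  set α := |A / (m + 2).factorial| with hα
  set β := |A / (m + 1).factorial| with hβ
  have hα0 : 0 < α := abs_pos.2 (by positivity)
  have hβ0 : 0 < β := abs_pos.2 (by positivity)
  have e1 := eventually_abs_sub_leading_term_le hso hsc hx₀ hc1 (fun i hi ↦ by
    rw [← iteratedDerivWithin_succ']; exact hvanish (i + 1) (by omega) (by omega)) (half_pos hα0)
  have e2 := eventually_abs_sub_leading_term_le hso hsc hx₀ hc2 (fun i hi ↦ by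
    rw [← iteratedDerivWithin_succ', ← iteratedDerivWithin_succ']
    exact hvanish (i + 2) (by omega) (by omega)) hβ0
  rw [hA1] at e1
  rw [hA2] at e2
  obtain ⟨ε, hε, hball⟩ := Metric.eventually_nhds_iff.1 ((hso.eventually_mem hx₀).and (e1.and e2))
  refine ⟨φ', φ'', ε / 2, α / 2, 2 * α + 2 * β, by positivity, by positivity, by positivity, ?_⟩
  intro x hx hxr
  have ht : 0 < x - x₀ := sub_pos.2 hx
  obtain ⟨hxs, h1, h2⟩ := hball (y := x) (by rw [Real.dist_eq, abs_of_pos ht]; linarith)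
  rw [abs_of_pos ht] at h1 h2
  have hp1 : 0 < (x - x₀) ^ (m + 2) := by positivity
  have hp2 : 0 < (x - x₀) ^ (m + 1) := by positivity
  have m1 : |A / (m + 2).factorial * (x - x₀) ^ (m + 2)| = α * (x - x₀) ^ (m + 2) := by
    rw [abs_mul, abs_of_pos hp1]
  have m2 : |A / (m + 1).factorial * (x - x₀) ^ (m + 1)| = β * (x - x₀) ^ (m + 1) := by
    rw [abs_mul, abs_of_pos hp2]
  refine ⟨hxs, hd (by omega) hφ hxs, hd (by omega) hc1 hxs, ?_, ?_, ?_⟩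
  · have := abs_sub_abs_le_abs_sub (A / (m + 2).factorial * (x - x₀) ^ (m + 2)) (φ' x)
    rw [abs_sub_comm, m1] at this
    linarith
  · have := abs_sub_abs_le_abs_sub (φ' x) (A / (m + 2).factorial * (x - x₀) ^ (m + 2))
    rw [m1] at this
    nlinarith [mul_pos hα0 hp1, mul_pos hβ0 hp1]
  · have := abs_sub_abs_le_abs_sub (φ'' x) (A / (m + 1).factorial * (x - x₀) ^ (m + 1))
    rw [m2] at this
    nlinarith [mul_pos hα0 hp2, mul_pos hβ0 hp2]

lemma e_add (s t : ℝ) : e (s + t) = e s * e t := by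
  simp only [e, ← Complex.exp_add]
  congr 1
  push_cast
  ring

lemma norm_e (t : ℝ) : ‖e t‖ = 1 := by
  have : e t = Complex.exp ((2 * Real.pi * t : ℝ) * Complex.I) := by
    rw [e]; congr 1; push_cast; ring
  rw [this, Complex.norm_exp_ofReal_mul_I]

lemma half_le_re_e {t : ℝ} (ht : |t| ≤ 1 / 8) : 1 / 2 ≤ (e t).re := by
  have : e t = Complex.exp ((2 * Real.pi * t : ℝ) * Complex.I) := by
    rw [e]; congr 1; push_cast; ring
  rw [this, Complex.exp_ofReal_mul_I_re]
  have h1 := Real.one_sub_sq_div_two_le_cos (x := 2 * Real.pi * t)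
  have h2 : (2 * Real.pi * t) ^ 2 ≤ 1 := by
    rw [sq_le_one_iff_abs_le_one, abs_mul, abs_of_pos Real.two_pi_pos]
    nlinarith [Real.pi_lt_four, Real.pi_pos, abs_nonneg t]
  linarith

/-- A sum of unimodular numbers whose phases are all within `1 / 8` of a common phase does not
cancel. -/
lemma half_card_le_norm_sum_e {ι : Type*} (S : Finset ι) (θ : ι → ℝ) (ω : ℝ)
    (h : ∀ n ∈ S, |θ n - ω| ≤ 1 / 8) : (S.card : ℝ) / 2 ≤ ‖∑ n ∈ S, e (θ n)‖ := by
  have h1 : ∑ n ∈ S, e (θ n) = e ω * ∑ n ∈ S, e (θ n - ω) := by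
    rw [Finset.mul_sum]
    refine Finset.sum_congr rfl fun n _ ↦ ?_
    rw [← e_add, add_sub_cancel]
  rw [h1, norm_mul, norm_e, one_mul]
  refine le_trans ?_ (Complex.re_le_norm _)
  rw [Complex.re_sum, div_eq_mul_one_div, ← nsmul_eq_mul]
  exact Finset.card_nsmul_le_sum _ _ _ fun n hn ↦ half_le_re_e (h n hn)

/-- Lower bound for an `L^p` norm from a pointwise lower bound on a subinterval. -/
lemma ofReal_mul_rpow_le_eLpNorm {F : ℝ → ℂ} {s : Set ℝ} {x δ C p : ℝ} (hp : 1 ≤ p)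
    (hδ : 0 ≤ δ) (hC : 0 ≤ C) (hs : Set.Icc x (x + δ) ⊆ s)
    (hF : ∀ y ∈ Set.Icc x (x + δ), C ≤ ‖F y‖) :
    ENNReal.ofReal (C * δ ^ (1 / p)) ≤ eLpNorm F (ENNReal.ofReal p) (volume.restrict s) := by
  have hp0 : 0 < p := by linarith
  refine le_trans ?_ (eLpNorm_mono_measure F (Measure.restrict_mono hs le_rfl))
  have h2 : eLpNorm (fun _ : ℝ ↦ C) (ENNReal.ofReal p) (volume.restrict (Set.Icc x (x + δ)))
      ≤ eLpNorm F (ENNReal.ofReal p) (volume.restrict (Set.Icc x (x + δ))) := by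
    refine eLpNorm_mono_ae ?_
    filter_upwards [ae_restrict_mem measurableSet_Icc] with y hy
    rw [Real.norm_of_nonneg hC]
    exact hF y hy
  refine le_trans (le_of_eq ?_) h2
  rw [eLpNorm_const' _ (by simpa using hp0) ENNReal.ofReal_ne_top, ENNReal.toReal_ofReal hp0.le,
    Measure.restrict_apply_univ, Real.volume_Icc, add_sub_cancel_left,
    Real.enorm_eq_ofReal hC, ENNReal.ofReal_mul hC, ENNReal.ofReal_rpow_of_nonneg hδ (by positivity)]

lemma le_card_Icc_ceil_floor {y R : ℝ} (hR : 1 ≤ R) :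
    R ≤ (Finset.Icc ⌈y - R⌉ ⌊y + R⌋).card := by
  rw [Int.card_Icc]
  have h1 := Int.ceil_lt_add_one (y - R)
  have h2 := Int.lt_floor_add_one (y + R)
  have h3 : ((⌊y + R⌋ + 1 - ⌈y - R⌉ : ℤ) : ℝ) ≤ ((⌊y + R⌋ + 1 - ⌈y - R⌉).toNat : ℝ) := by
    exact_mod_cast Int.self_le_toNat _
  push_cast at h3
  linarith

/-- First-order Taylor bounds on an interval on which `φ'` and `φ''` are bounded. -/
lemma abs_sub_le_of_deriv_bounds {φ φ' φ'' : ℝ → ℝ} {x₁ δ P Q : ℝ}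
    (h1 : ∀ x ∈ Set.Icc x₁ (x₁ + δ), HasDerivAt φ (φ' x) x)
    (h2 : ∀ x ∈ Set.Icc x₁ (x₁ + δ), HasDerivAt φ' (φ'' x) x)
    (hP : ∀ x ∈ Set.Icc x₁ (x₁ + δ), |φ' x| ≤ P)
    (hQ : ∀ x ∈ Set.Icc x₁ (x₁ + δ), |φ'' x| ≤ Q) {x : ℝ} (hx : x ∈ Set.Icc x₁ (x₁ + δ)) :
    |φ x - φ x₁| ≤ P * δ ∧ |φ x - φ x₁ - φ' x₁ * (x - x₁)| ≤ Q * δ ^ 2 := by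
  have hδ : 0 ≤ δ := by linarith [hx.1, hx.2]
  have hx₁ : x₁ ∈ Set.Icc x₁ (x₁ + δ) := ⟨le_rfl, by linarith⟩
  have hP0 : 0 ≤ P := (abs_nonneg _).trans (hP x₁ hx₁)
  have hQ0 : 0 ≤ Q := (abs_nonneg _).trans (hQ x₁ hx₁)
  have hxd {y : ℝ} (hy : y ∈ Set.Icc x₁ (x₁ + δ)) : |y - x₁| ≤ δ := by
    rw [abs_of_nonneg (by linarith [hy.1])]; linarith [hy.2]
  have hcv : Convex ℝ (Set.Icc x₁ (x₁ + δ)) := convex_Icc _ _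
  constructor
  · have := hcv.norm_image_sub_le_of_norm_hasDerivWithin_le
      (fun y hy ↦ (h1 y hy).hasDerivWithinAt) hP hx₁ hx
    exact this.trans (mul_le_mul_of_nonneg_left (hxd hx) hP0)
  · have h3 : ∀ y ∈ Set.Icc x₁ (x₁ + δ), ‖φ' y - φ' x₁‖ ≤ Q * δ := by
      intro y hy
      have := hcv.norm_image_sub_le_of_norm_hasDerivWithin_le
        (fun z hz ↦ (h2 z hz).hasDerivWithinAt) hQ hx₁ hy
      exact this.trans (mul_le_mul_of_nonneg_left (hxd hy) hQ0)
    have h4 := hcv.norm_image_sub_le_of_norm_hasDerivWithin_le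
      (f := fun y ↦ φ y - φ' x₁ * y) (f' := fun y ↦ φ' y - φ' x₁)
      (fun y hy ↦
        ((h1 y hy).sub (by simpa using (hasDerivAt_id y).const_mul (φ' x₁))).hasDerivWithinAt)
      h3 hx₁ hx
    have h5 : φ x - φ' x₁ * x - (φ x₁ - φ' x₁ * x₁) = φ x - φ x₁ - φ' x₁ * (x - x₁) := by ring
    rw [h5] at h4
    calc |φ x - φ x₁ - φ' x₁ * (x - x₁)| ≤ Q * δ * |x - x₁| := h4
      _ ≤ Q * δ * δ := mul_le_mul_of_nonneg_left (hxd hx) (by positivity)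
      _ = Q * δ ^ 2 := by ring

/-- A block of frequencies around `ν`, where `x₁` is the stationary point of `x - 2 * ν * φ x`,
adds up coherently near `x₁`. -/
lemma half_card_le_norm_sum_block {φ φ' φ'' : ℝ → ℝ} {x₁ δ P Q ν R : ℝ}
    (h1 : ∀ x ∈ Set.Icc x₁ (x₁ + δ), HasDerivAt φ (φ' x) x)
    (h2 : ∀ x ∈ Set.Icc x₁ (x₁ + δ), HasDerivAt φ' (φ'' x) x)
    (hP : ∀ x ∈ Set.Icc x₁ (x₁ + δ), |φ' x| ≤ P)
    (hQ : ∀ x ∈ Set.Icc x₁ (x₁ + δ), |φ'' x| ≤ Q)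
    (hν : 2 * ν * φ' x₁ = 1) (S : Finset ℤ) (hS : ∀ n ∈ S, |(n : ℝ) - ν| ≤ R)
    (hR₁ : R * (2 * |ν|) * (Q * δ ^ 2) ≤ 1 / 16) (hR₂ : R ^ 2 * (P * δ) ≤ 1 / 16)
    {x : ℝ} (hx : x ∈ Set.Icc x₁ (x₁ + δ)) :
    (S.card : ℝ) / 2 ≤
      ‖∑ n ∈ S, e (-((n : ℝ) * x₁ - (n : ℝ) ^ 2 * φ x₁)) * e ((n : ℝ) * x - (n : ℝ) ^ 2 * φ x)‖ := by
  obtain ⟨hD1, hD2⟩ := abs_sub_le_of_deriv_bounds h1 h2 hP hQ hx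
  simp_rw [← e_add]
  refine half_card_le_norm_sum_e S _ (ν * (x - x₁) - ν ^ 2 * (φ x - φ x₁)) fun n hn ↦ ?_
  have hm := hS n hn
  have hR : 0 ≤ R := (abs_nonneg _).trans hm
  set D := φ x - φ x₁ with hD
  set μ := (n : ℝ) - ν with hμ
  have key : -((n : ℝ) * x₁ - (n : ℝ) ^ 2 * φ x₁) + ((n : ℝ) * x - (n : ℝ) ^ 2 * φ x)
      - (ν * (x - x₁) - ν ^ 2 * D)
      = -(μ * (2 * ν) * (D - φ' x₁ * (x - x₁))) - μ ^ 2 * D := by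
    rw [hμ, hD]
    linear_combination (-((n : ℝ) - ν) * (x - x₁)) * hν
  rw [key]
  have b1 : |μ * (2 * ν) * (D - φ' x₁ * (x - x₁))| ≤ R * (2 * |ν|) * (Q * δ ^ 2) := by
    rw [abs_mul, abs_mul, abs_mul 2 ν, abs_two]
    gcongr
  have b2 : |μ ^ 2 * D| ≤ R ^ 2 * (P * δ) := by
    rw [abs_mul, abs_pow]
    gcongr
  refine (abs_sub _ _).trans ?_
  rw [abs_neg]
  linarith

/-- The single frequency zero has `L^p(-1,1)` norm at least `1`. -/
lemma one_le_eLpNorm_single_zero (φ : ℝ → ℝ) (N : ℕ) {p : ℝ} (hp : 1 ≤ p) :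
    1 ≤ eLpNorm (fun x : ℝ => ∑ n ∈ Finset.Icc (-(N:ℤ)) (N:ℤ),
      (Pi.single 0 1 : ℤ → ℂ) n * e ((n:ℝ) * x - (n:ℝ)^2 * φ x))
        (ENNReal.ofReal p) (volume.restrict (Set.Ioo (-1) 1)) := by
  have := ofReal_mul_rpow_le_eLpNorm (F := fun x : ℝ => ∑ n ∈ Finset.Icc (-(N:ℤ)) (N:ℤ),
      (Pi.single 0 1 : ℤ → ℂ) n * e ((n:ℝ) * x - (n:ℝ)^2 * φ x))
      (s := Set.Ioo (-1) 1) (x := -1 / 2) (δ := 1) (C := 1) hp zero_le_one zero_le_one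
      (fun y hy ↦ ⟨by linarith [hy.1], by linarith [hy.2]⟩) (fun y _ ↦ by
        rw [Finset.sum_eq_single 0 (fun n _ hn ↦ by simp [hn]) (fun h ↦ by simp at h)]
        simp [norm_e])
  simpa using this

/-- Relations between the scales `Y ^ (-1 / (m + 2))` (distance to the critical point),
`Y ^ ((2 * m + 5) / (3 * (m + 2)))` (length of the block of frequencies) and
`Y ^ (-(m + 4) / (3 * (m + 2)))` (length of the interval). -/
lemma scale_relations {Y : ℝ} (hY : 1 ≤ Y) (m : ℕ) {s M δ : ℝ}
    (hs : s = Y ^ (-(1 / ((m : ℝ) + 2)))) (hM : M = Y ^ ((2 * (m : ℝ) + 5) / (3 * (m + 2))))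
    (hδ : δ = Y ^ (-(((m : ℝ) + 4) / (3 * (m + 2))))) :
    s ^ (m + 2) * Y = 1 ∧ M ^ 2 * δ = Y ∧ M * δ ^ 2 = s ∧ M ≤ Y ∧ δ ≤ s := by
  have hY0 : 0 < Y := by linarith
  have hm : (m : ℝ) + 2 ≠ 0 := by positivity
  refine ⟨?_, ?_, ?_, ?_, ?_⟩
  · rw [hs, ← Real.rpow_natCast, ← Real.rpow_mul hY0.le, ← Real.rpow_add_one hY0.ne']
    convert Real.rpow_zero Y
    push_cast
    field_simp
    ring
  · rw [hM, hδ, ← Real.rpow_natCast, ← Real.rpow_mul hY0.le, ← Real.rpow_add hY0]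
    convert Real.rpow_one Y
    push_cast
    field_simp
    ring
  · rw [hM, hδ, hs, ← Real.rpow_natCast, ← Real.rpow_mul hY0.le, ← Real.rpow_add hY0]
    congr 1
    push_cast
    field_simp
    ring
  · rw [hM]
    refine (Real.rpow_le_rpow_of_exponent_le hY ?_).trans_eq (Real.rpow_one Y)
    rw [div_le_one (by positivity)]
    have : (0 : ℝ) ≤ m := by positivity
    linarith
  · rw [hδ, hs]
    refine Real.rpow_le_rpow_of_exponent_le hY (neg_le_neg ?_)
    rw [div_le_div_iff₀ (by positivity) (by positivity)]
    have : (0 : ℝ) ≤ m := by positivity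
    nlinarith

/-- For large `N` a coherent block of frequencies witnesses the lower bound. -/
lemma eventually_exists_coherent_block {φ φ' φ'' : ℝ → ℝ} {x₀ r b B : ℝ} {m : ℕ} {s : Set ℝ}
    (hr : 0 < r) (hb : 0 < b) (hB : 0 < B)
    (h : ∀ x, x₀ < x → x ≤ x₀ + r → x ∈ s ∧ HasDerivAt φ (φ' x) x ∧ HasDerivAt φ' (φ'' x) x ∧
        b * (x - x₀) ^ (m + 2) ≤ |φ' x| ∧ |φ' x| ≤ B * (x - x₀) ^ (m + 2) ∧
        |φ'' x| ≤ B * (x - x₀) ^ (m + 1)) :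
    ∃ ε > 0, ∀ᶠ N : ℕ in atTop, ∃ (S : Finset ℤ) (x₁ : ℝ), S ⊆ Finset.Icc (-(N : ℤ)) N ∧
      0 < ε * (N : ℝ) ^ ((2 * (m : ℝ) + 5) / (3 * (m + 2))) ∧
      ε * (N : ℝ) ^ ((2 * (m : ℝ) + 5) / (3 * (m + 2))) ≤ S.card ∧
      Set.Icc x₁ (x₁ + (N : ℝ) ^ (-(((m : ℝ) + 4) / (3 * (m + 2))))) ⊆ s ∧
      ∀ x ∈ Set.Icc x₁ (x₁ + (N : ℝ) ^ (-(((m : ℝ) + 4) / (3 * (m + 2))))), (S.card : ℝ) / 2 ≤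
        ‖∑ n ∈ S, e (-((n : ℝ) * x₁ - (n : ℝ) ^ 2 * φ x₁)) *
          e ((n : ℝ) * x - (n : ℝ) ^ 2 * φ x)‖ := by
  set τ := max 1 (1 / b) with hτ
  have hτ1 : 1 ≤ τ := le_max_left _ _
  have hτb : 1 ≤ b * τ ^ (m + 2) := by
    have h1 : 1 / b ≤ τ ^ (m + 2) := (le_max_right _ _).trans (le_self_pow₀ hτ1 (by omega))
    rwa [div_le_iff₀' hb] at h1
  set K := B * (2 * τ) ^ (m + 2) with hK
  have hK0 : 0 < K := by positivity
  set ε := 1 / (16 * (K + 1)) with hε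
  have hε0 : 0 < ε := by positivity
  have hεK : ε * K ≤ 1 / 16 := by
    rw [hε, div_mul_eq_mul_div, div_le_div_iff₀ (by positivity) (by norm_num)]
    linarith
  have hε2 : ε ≤ 1 / 2 := by
    rw [hε]
    exact one_div_le_one_div_of_le two_pos (by linarith)
  refine ⟨ε, hε0, ?_⟩
  have hs_lim : Tendsto (fun N : ℕ ↦ 2 * τ * (N : ℝ) ^ (-(1 / ((m : ℝ) + 2)))) atTop (𝓝 0) := by
    simpa using ((tendsto_rpow_neg_atTop (y := 1 / ((m : ℝ) + 2)) (by positivity)).comp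
      tendsto_natCast_atTop_atTop).const_mul (2 * τ)
  have hM_lim : Tendsto (fun N : ℕ ↦ ε * (N : ℝ) ^ ((2 * (m : ℝ) + 5) / (3 * (m + 2))))
      atTop atTop :=
    ((tendsto_rpow_atTop (by positivity)).comp tendsto_natCast_atTop_atTop).const_mul_atTop hε0
  filter_upwards [hs_lim.eventually_le_const hr, hM_lim.eventually_ge_atTop 1,
    eventually_ge_atTop 1] with N hsr hR1 hN
  have hY : (1 : ℝ) ≤ N := by exact_mod_cast hN
  set Y : ℝ := (N : ℝ) with hYdef
  have hY0 : 0 < Y := by linarith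
  set σ := Y ^ (-(1 / ((m : ℝ) + 2))) with hσ
  set M := Y ^ ((2 * (m : ℝ) + 5) / (3 * (m + 2))) with hM
  set δ := Y ^ (-(((m : ℝ) + 4) / (3 * (m + 2)))) with hδ
  obtain ⟨r1, r2, r3, r4, r5⟩ := scale_relations hY m hσ hM hδ
  have hσ0 : 0 < σ := by positivity
  have hM0 : 0 < M := by positivity
  have hδ0 : 0 < δ := by positivity
  set x₁ := x₀ + τ * σ with hx₁
  have hτσ : σ ≤ τ * σ := le_mul_of_one_le_left hσ0.le hτ1
  have hloc : ∀ x ∈ Set.Icc x₁ (x₁ + δ), x₀ < x ∧ x ≤ x₀ + r ∧ x - x₀ ≤ 2 * τ * σ := by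
    intro x hx
    refine ⟨?_, ?_, ?_⟩ <;> linarith [hx.1, hx.2]
  have hx₁mem : x₁ ∈ Set.Icc x₁ (x₁ + δ) := ⟨le_rfl, by linarith⟩
  have hP : ∀ x ∈ Set.Icc x₁ (x₁ + δ), |φ' x| ≤ K / Y := by
    intro x hx
    obtain ⟨l1, l2, l3⟩ := hloc x hx
    have l4 : 0 ≤ x - x₀ := by linarith
    refine (h x l1 l2).2.2.2.2.1.trans ?_
    rw [le_div_iff₀ hY0]
    calc B * (x - x₀) ^ (m + 2) * Y ≤ B * (2 * τ * σ) ^ (m + 2) * Y := by gcongr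
      _ = K * (σ ^ (m + 2) * Y) := by rw [hK, mul_pow (2 * τ)]; ring
      _ = K := by rw [r1, mul_one]
  have hQ : ∀ x ∈ Set.Icc x₁ (x₁ + δ), |φ'' x| ≤ K * σ ^ (m + 1) := by
    intro x hx
    obtain ⟨l1, l2, l3⟩ := hloc x hx
    have l4 : 0 ≤ x - x₀ := by linarith
    refine (h x l1 l2).2.2.2.2.2.trans ?_
    calc B * (x - x₀) ^ (m + 1) ≤ B * (2 * τ * σ) ^ (m + 1) := by gcongr
      _ = B * (2 * τ) ^ (m + 1) * σ ^ (m + 1) := by rw [mul_pow (2 * τ)]; ring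
      _ ≤ K * σ ^ (m + 1) := by
        rw [hK]
        gcongr
        · linarith
        · omega
  have hφ₁ : 1 / Y ≤ |φ' x₁| := by
    obtain ⟨l1, l2, -⟩ := hloc x₁ hx₁mem
    refine le_trans ?_ (h x₁ l1 l2).2.2.2.1
    rw [div_le_iff₀ hY0, hx₁, add_sub_cancel_left, mul_pow]
    calc 1 ≤ b * τ ^ (m + 2) := hτb
      _ = b * τ ^ (m + 2) * (σ ^ (m + 2) * Y) := by rw [r1, mul_one]
      _ = _ := by ring
  have hφ₁0 : 0 < |φ' x₁| := lt_of_lt_of_le (by positivity) hφ₁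
  have hφ₁ne : φ' x₁ ≠ 0 := abs_pos.1 hφ₁0
  set ν := 1 / (2 * φ' x₁) with hν
  have hνeq : 2 * ν * φ' x₁ = 1 := by rw [hν]; field_simp
  have hνY : 2 * |ν| ≤ Y := by
    have h3 : 2 * |ν| * |φ' x₁| = 1 := by
      rw [← abs_two, ← abs_mul, ← abs_mul, hνeq, abs_one]
    rw [div_le_iff₀ hY0] at hφ₁
    by_contra! hcon
    nlinarith
  set S := Finset.Icc ⌈ν - ε * M⌉ ⌊ν + ε * M⌋ with hS
  have hSmem : ∀ n ∈ S, |(n : ℝ) - ν| ≤ ε * M := by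
    intro n hn
    rw [hS, Finset.mem_Icc, Int.ceil_le, Int.le_floor] at hn
    rw [abs_le]
    constructor <;> linarith [hn.1, hn.2]
  refine ⟨S, x₁, ?_, by positivity, le_card_Icc_ceil_floor hR1, ?_, ?_⟩
  · intro n hn
    have h1 := hSmem n hn
    have h2 : ε * M ≤ 1 / 2 * Y := mul_le_mul hε2 r4 hM0.le (by norm_num)
    have h3 : |(n : ℝ)| ≤ Y := by
      have := abs_sub_abs_le_abs_sub (n : ℝ) ν
      linarith
    rw [hYdef, abs_le] at h3
    rw [Finset.mem_Icc]
    exact ⟨by exact_mod_cast h3.1, by exact_mod_cast h3.2⟩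
  · intro x hx
    obtain ⟨l1, l2, -⟩ := hloc x hx
    exact (h x l1 l2).1
  · intro x hx
    have hd {y : ℝ} (hy : y ∈ Set.Icc x₁ (x₁ + δ)) := h y (hloc y hy).1 (hloc y hy).2.1
    refine half_card_le_norm_sum_block (fun y hy ↦ (hd hy).2.1) (fun y hy ↦ (hd hy).2.2.1) hP hQ
      hνeq S hSmem ?_ ?_ hx
    · calc ε * M * (2 * |ν|) * (K * σ ^ (m + 1) * δ ^ 2)
          ≤ ε * M * Y * (K * σ ^ (m + 1) * δ ^ 2) := by gcongr
        _ = ε * K * (σ ^ (m + 1) * (M * δ ^ 2) * Y) := by ring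
        _ = ε * K := by rw [r3, ← pow_succ, r1, mul_one]
        _ ≤ 1 / 16 := hεK
    · calc (ε * M) ^ 2 * (K / Y * δ) = ε * (ε * K) * (M ^ 2 * δ / Y) := by ring
        _ = ε * (ε * K) := by rw [r2, div_self hY0.ne', mul_one]
        _ ≤ 1 * (1 / 16) := by gcongr; linarith
        _ = 1 / 16 := one_mul _

/-- **Theorem 3 (lower bounds).** Let `k ≥ 3` and `φ ∈ C^{k+1}(-1,1)` with
`φ'(x₀) = ⋯ = φ^{(k−1)}(x₀) = 0` and `φ^{(k)}(x₀) ≠ 0` for some `x₀ ∈ (-1,1)`. Then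
there is `c > 0` (depending on `φ` but not on `N`) such that for every `N ≥ 1` there are
coefficients `(a_n)_{n=-N}^N`, not all zero, satisfying for every real `p ≥ 2`:
`‖∑ a_n e(nx − n²φ(x))‖_{L^p(-1,1)} ≥ c N^{(2k−1)/(6(k−1)) − (k+1)/(3p(k−1))} (∑|a_n|²)^{1/2}`. -/
theorem stmt3 (k : ℕ) (hk : 3 ≤ k) (φ : ℝ → ℝ)
    (hφ : ContDiffOn ℝ (k + 1) φ (Set.Ioo (-1) 1))
    (x₀ : ℝ) (hx₀ : x₀ ∈ Set.Ioo (-1:ℝ) 1)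
    (hvanish : ∀ i : ℕ, 1 ≤ i → i ≤ k - 1 →
      iteratedDerivWithin i φ (Set.Ioo (-1) 1) x₀ = 0)
    (hnonzero : iteratedDerivWithin k φ (Set.Ioo (-1) 1) x₀ ≠ 0) :
    ∃ c > 0, ∀ N : ℕ, 0 < N → ∃ a : ℤ → ℂ,
      (∃ n ∈ Finset.Icc (-(N:ℤ)) (N:ℤ), a n ≠ 0) ∧
      ∀ p : ℝ, 2 ≤ p →
        ENNReal.ofReal
            (c * (N:ℝ) ^ ((2*(k:ℝ) - 1) / (6 * ((k:ℝ) - 1))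
                - ((k:ℝ) + 1) / (3 * p * ((k:ℝ) - 1))) *
              Real.sqrt (∑ n ∈ Finset.Icc (-(N:ℤ)) (N:ℤ), ‖a n‖^2))
          ≤ eLpNorm (fun x : ℝ =>
              ∑ n ∈ Finset.Icc (-(N:ℤ)) (N:ℤ), a n * e ((n:ℝ) * x - (n:ℝ)^2 * φ x))
            (ENNReal.ofReal p) (volume.restrict (Set.Ioo (-1) 1)) := by
  obtain ⟨m, rfl⟩ : ∃ m, k = m + 3 := ⟨k - 3, by omega⟩
  obtain ⟨φ', φ'', r, b, B, hr, hb, hB, h⟩ := exists_deriv_bounds_of_degenerate isOpen_Ioo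
    (convex_Ioo (-1 : ℝ) 1) hx₀ (hφ.of_le (by norm_cast; omega))
    (fun i hi hi' ↦ hvanish i hi (by omega)) hnonzero
  obtain ⟨ε, hε, hev⟩ := eventually_exists_coherent_block hr hb hB h
  obtain ⟨N₀, hN₀⟩ := eventually_atTop.1 hev
  have hc0 : 0 < min (√ε / 2) (1 / ((N₀ : ℝ) + 1)) := lt_min (by positivity) (by positivity)
  refine ⟨min (√ε / 2) (1 / ((N₀ : ℝ) + 1)), hc0, fun N hN ↦ ?_⟩
  set c := min (√ε / 2) (1 / ((N₀ : ℝ) + 1)) with hc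
  have hY : (1 : ℝ) ≤ N := by exact_mod_cast hN
  have hY0 : (0 : ℝ) < N := by linarith
  push_cast
  rw [show (m : ℝ) + 3 - 1 = m + 2 by ring]
  rcases le_or_gt N₀ N with hNN | hNN
  · obtain ⟨S, x₁, hSN, hR0, hR, hIs, hlow⟩ := hN₀ N hNN
    have hcard : (0 : ℝ) < S.card := hR0.trans_le hR
    refine ⟨fun n ↦ if n ∈ S then e (-((n : ℝ) * x₁ - (n : ℝ) ^ 2 * φ x₁)) else 0, ?_, ?_⟩
    · obtain ⟨n, hn⟩ := Finset.card_pos.1 (by exact_mod_cast hcard : 0 < S.card)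
      refine ⟨n, hSN hn, ?_⟩
      simp only [if_pos hn]
      rw [← norm_ne_zero_iff, norm_e]
      exact one_ne_zero
    · intro p hp
      have hp0 : 0 < p := by linarith
      have hsum : ∑ n ∈ Finset.Icc (-(N:ℤ)) (N:ℤ),
          ‖if n ∈ S then e (-((n : ℝ) * x₁ - (n : ℝ) ^ 2 * φ x₁)) else 0‖ ^ 2 = S.card := by
        rw [← Finset.sum_subset hSN fun n _ hn ↦ by simp [hn],
          Finset.sum_congr rfl fun n hn ↦ by rw [if_pos hn, norm_e, one_pow]]
        simp
      rw [hsum]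
      have hF : ∀ x ∈ Set.Icc x₁ (x₁ + (N : ℝ) ^ (-(((m : ℝ) + 4) / (3 * (m + 2))))),
          (S.card : ℝ) / 2 ≤ ‖∑ n ∈ Finset.Icc (-(N:ℤ)) (N:ℤ),
            (if n ∈ S then e (-((n : ℝ) * x₁ - (n : ℝ) ^ 2 * φ x₁)) else 0) *
              e ((n:ℝ) * x - (n:ℝ)^2 * φ x)‖ := by
        intro x hx
        rw [← Finset.sum_subset hSN fun n _ hn ↦ by simp [hn],
          Finset.sum_congr rfl fun n hn ↦ by rw [if_pos hn]]
        exact hlow x hx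
      refine le_trans (ENNReal.ofReal_le_ofReal ?_)
        (ofReal_mul_rpow_le_eLpNorm (by linarith) (by positivity) (by positivity) hIs hF)
      have hexp : (N : ℝ) ^ ((2 * ((m : ℝ) + 3) - 1) / (6 * ((m : ℝ) + 2))
            - ((m : ℝ) + 3 + 1) / (3 * p * ((m : ℝ) + 2)))
          = √((N : ℝ) ^ ((2 * (m : ℝ) + 5) / (3 * (m + 2)))) *
            ((N : ℝ) ^ (-(((m : ℝ) + 4) / (3 * (m + 2))))) ^ (1 / p) := by
        rw [Real.sqrt_eq_rpow, ← Real.rpow_mul hY0.le, ← Real.rpow_mul hY0.le,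
          ← Real.rpow_add hY0]
        congr 1
        field_simp
        ring
      rw [hexp]
      have h1 : √ε * √((N : ℝ) ^ ((2 * (m : ℝ) + 5) / (3 * (m + 2)))) ≤ √(S.card : ℝ) := by
        rw [← Real.sqrt_mul hε.le]
        exact Real.sqrt_le_sqrt hR
      set Δ := ((N : ℝ) ^ (-(((m : ℝ) + 4) / (3 * (m + 2))))) ^ (1 / p)
      set μ := √((N : ℝ) ^ ((2 * (m : ℝ) + 5) / (3 * (m + 2))))
      calc c * (μ * Δ) * √(S.card : ℝ) ≤ √ε / 2 * (μ * Δ) * √(S.card : ℝ) := by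
            gcongr
            exact min_le_left _ _
        _ = √ε * μ * (√(S.card : ℝ) / 2 * Δ) := by ring
        _ ≤ √(S.card : ℝ) * (√(S.card : ℝ) / 2 * Δ) := by gcongr
        _ = √(S.card : ℝ) * √(S.card : ℝ) / 2 * Δ := by ring
        _ = (S.card : ℝ) / 2 * Δ := by rw [Real.mul_self_sqrt hcard.le]
  · refine ⟨Pi.single 0 1, ⟨0, by simp, by simp⟩, fun p hp ↦ ?_⟩
    refine le_trans ?_ (one_le_eLpNorm_single_zero φ N (by linarith))
    rw [Finset.sum_eq_single 0 (fun n _ hn ↦ by simp [hn]) (fun h ↦ by simp at h)]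
    simp only [Pi.single_eq_same, norm_one, one_pow, Real.sqrt_one, mul_one]
    rw [ENNReal.ofReal_le_one]
    have hexp : (2 * ((m : ℝ) + 3) - 1) / (6 * ((m : ℝ) + 2))
        - ((m : ℝ) + 3 + 1) / (3 * p * ((m : ℝ) + 2)) ≤ 1 := by
      have h1 : (2 * ((m : ℝ) + 3) - 1) / (6 * ((m : ℝ) + 2)) ≤ 1 := by
        rw [div_le_one (by positivity)]
        linarith [(Nat.cast_nonneg m : (0 : ℝ) ≤ m)]
      have h2 : 0 ≤ ((m : ℝ) + 3 + 1) / (3 * p * ((m : ℝ) + 2)) := by positivity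
      linarith
    have hNN' : (N : ℝ) ≤ N₀ + 1 := by exact_mod_cast (by omega : N ≤ N₀ + 1)
    calc _ ≤ 1 / ((N₀ : ℝ) + 1) * ((N₀ : ℝ) + 1) := by
          refine mul_le_mul (min_le_right _ _) ?_ (by positivity) (by positivity)
          exact ((Real.rpow_le_rpow_of_exponent_le hY hexp).trans_eq (Real.rpow_one _)).trans hNN'
      _ = 1 := by field_simp
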